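/- Define F^i C^m = {ω ∈ ⊕_{i'≥i} K^{i'}⊗ℝ[u] of total degree m : ∇ω ∈ ⊕_{i'≥i} K^{i'}⊗ℝ[u]}. Then for all i, j ≥ 0: (i) F^i C^{i+2j} = (Ω^i × {0}) ⊗ ℝ·u^j ⊕ ⊕_{k=1}^{j} K^{i+2k} ⊗ ℝ·u^{j−k} and F^i C^{i+2j+1} = K^{i+1} ⊗ ℝ·u^j ⊕ ⊕_{k=1}^{j} K^{i+1+2k} ⊗ ℝ·u^{j−k}; (ii) ∇(F^i C^m) ⊆ F^i C^{m+1}; (iii) F^0 C^m = C^m and F^{m+1} C^m = 0. -/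

import Mathlib

/-!
Common algebraic model for the paper "Intersection cohomology of circle actions"
(Padilla–Saralegi), following the CONTEXT of the statements.

`A` models the (total space of the) graded-commutative differential graded ℝ-algebra
`A = ⊕ₙ Aⁿ` of liftable forms on the orbit space `B`; the grading is only recorded
through the families of graded subspaces `P Q : ℤ → Submodule ℝ A` (the forms of
perverse degree `≤ p̄` resp. `≤ p̄ - x̄`), which vanish in negative degrees
(`Aⁿ = 0` for `n < 0`).  The differential is `d` with `d ∘ d = 0`, and
`e : A →ₗ[ℝ] A` is right multiplication by the fixed Euler form `ε ∈ A²`;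
the hypotheses `dε = 0` together with the graded Leibniz rule amount exactly to
the commutation `d ∘ e = e ∘ d`, which is how we encode them.
-/

open Submodule LinearMap

noncomputable section

namespace IG

variable {A : Type*} [AddCommGroup A] [Module ℝ A]

/-- `Ω^n = {α ∈ P^n : dα ∈ P^(n+1)}`. -/
def Om (d : A →ₗ[ℝ] A) (P : ℤ → Submodule ℝ A) (n : ℤ) : Submodule ℝ A :=
  P n ⊓ (P (n + 1)).comap d

/-- First component of `D` in degree `n` : `(α, β) ↦ dα + (-1)^(n-1) β∧ε`. -/
def D1 (d e : A →ₗ[ℝ] A) (n : ℤ) : A × A →ₗ[ℝ] A :=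
  d ∘ₗ LinearMap.fst ℝ A A + ((-1 : ℝ) ^ (n - 1)) • (e ∘ₗ LinearMap.snd ℝ A A)

/-- `D(α,β) = (dα + (-1)^(n-1) β∧ε, dβ)` in degree `n`. -/
def Dmap (d e : A →ₗ[ℝ] A) (n : ℤ) : A × A →ₗ[ℝ] A × A :=
  (D1 d e n).prod (d ∘ₗ LinearMap.snd ℝ A A)

/-- `K^n = {(α,β) ∈ P^n × Q^(n-1) : dβ ∈ Q^n, dα + (-1)^(n-1) β∧ε ∈ P^(n+1)}`. -/
def Ksub (d e : A →ₗ[ℝ] A) (P Q : ℤ → Submodule ℝ A) (n : ℤ) : Submodule ℝ (A × A) :=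
  (P n).comap (LinearMap.fst ℝ A A) ⊓ (Q (n - 1)).comap (LinearMap.snd ℝ A A) ⊓
    (Q n).comap (d ∘ₗ LinearMap.snd ℝ A A) ⊓ (P (n + 1)).comap (D1 d e n)

/-- `G^n = {β ∈ Q^n : dβ ∈ Q^(n+1), ∃ α ∈ P^(n+1), dα + (-1)^n β∧ε ∈ P^(n+2)}`. -/
def Gsub (d e : A →ₗ[ℝ] A) (P Q : ℤ → Submodule ℝ A) (n : ℤ) : Submodule ℝ A :=
  Q n ⊓ (Q (n + 1)).comap d ⊓
    (((P (n + 1)).comap (LinearMap.fst ℝ A A) ⊓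
        (P (n + 2)).comap
          (d ∘ₗ LinearMap.fst ℝ A A + ((-1 : ℝ) ^ n) • (e ∘ₗ LinearMap.snd ℝ A A))).map
      (LinearMap.snd ℝ A A))

/-- `C^m = ⊕_{i+2j=m} K^i ⊗ ℝ·u^j`, realized as the functions `ω : ℕ → A × A`
(`ω j` = the coefficient of `u^j`) with `ω j ∈ K^(m-2j)` for all `j`. -/
def Csub (d e : A →ₗ[ℝ] A) (P Q : ℤ → Submodule ℝ A) (m : ℤ) : Submodule ℝ (ℕ → A × A) :=
  ⨅ j : ℕ, (Ksub d e P Q (m - 2 * (j : ℤ))).comap (LinearMap.proj (R := ℝ) j)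

/-- `∇((α,β) ⊗ u^j) = D(α,β) ⊗ u^j + (-1)^(n-1) (β,0) ⊗ u^(j+1)` on total degree `m`. -/
def nabla (d e : A →ₗ[ℝ] A) (m : ℤ) : (ℕ → A × A) →ₗ[ℝ] (ℕ → A × A) :=
  LinearMap.pi fun j : ℕ =>
    Dmap d e (m - 2 * (j : ℤ)) ∘ₗ LinearMap.proj j +
      if j = 0 then 0
      else ((-1 : ℝ) ^ (m - 2 * ((j : ℤ) - 1) - 1)) •
        (LinearMap.inl ℝ A A ∘ₗ LinearMap.snd ℝ A A ∘ₗ LinearMap.proj (j - 1))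

/-- Multiplication by `u` (degree 2) on an `ℝ[u]`-module realized as `ℕ → M`. -/
def shiftL (M : Type*) [AddCommGroup M] [Module ℝ M] : (ℕ → M) →ₗ[ℝ] (ℕ → M) :=
  LinearMap.pi fun j : ℕ => if j = 0 then 0 else LinearMap.proj (j - 1)

/-- `π' (α ⊗ u^j) = (α, 0) ⊗ u^j`. -/
def piMap : (ℕ → A) →ₗ[ℝ] ℕ → A × A :=
  LinearMap.pi fun j : ℕ => LinearMap.inl ℝ A A ∘ₗ LinearMap.proj j

/-- `∮' ((α,β) ⊗ u^j) = β ⊗ u^j`. -/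
def ointMap : (ℕ → A × A) →ₗ[ℝ] ℕ → A :=
  LinearMap.pi fun j : ℕ => LinearMap.snd ℝ A A ∘ₗ LinearMap.proj j

/-- `d ⊗ 1`. -/
def dpi (d : A →ₗ[ℝ] A) : (ℕ → A) →ₗ[ℝ] ℕ → A :=
  LinearMap.pi fun j : ℕ => d ∘ₗ LinearMap.proj j

/-- `(Ω ⊗ ℝ[u])^m`. -/
def OmC (d : A →ₗ[ℝ] A) (P : ℤ → Submodule ℝ A) (m : ℤ) : Submodule ℝ (ℕ → A) :=
  ⨅ j : ℕ, (Om d P (m - 2 * (j : ℤ))).comap (LinearMap.proj (R := ℝ) j)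

/-- `(G[-1] ⊗ ℝ[u])^m` (`G[-1]` places `G^n` in degree `n+1`). -/
def GCs (d e : A →ₗ[ℝ] A) (P Q : ℤ → Submodule ℝ A) (m : ℤ) : Submodule ℝ (ℕ → A) :=
  ⨅ j : ℕ, (Gsub d e P Q (m - 1 - 2 * (j : ℤ))).comap (LinearMap.proj (R := ℝ) j)

/-- Cohomology presented as (cocycles) / (coboundaries). -/
abbrev Hq {M : Type*} [AddCommGroup M] [Module ℝ M] (Z B : Submodule ℝ M) :=
  Z ⧸ (B.comap Z.subtype)

/-- Cocycles of `Ω`. -/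
def ZOm (d : A →ₗ[ℝ] A) (P : ℤ → Submodule ℝ A) (n : ℤ) : Submodule ℝ A :=
  Om d P n ⊓ LinearMap.ker d

/-- Coboundaries of `Ω`. -/
def BOm (d : A →ₗ[ℝ] A) (P : ℤ → Submodule ℝ A) (n : ℤ) : Submodule ℝ A :=
  (Om d P (n - 1)).map d

/-- `H^n(Ω)`. -/
abbrev HOm (d : A →ₗ[ℝ] A) (P : ℤ → Submodule ℝ A) (n : ℤ) :=
  Hq (ZOm d P n) (BOm d P n)

/-- Cocycles of `G`. -/
def ZG (d e : A →ₗ[ℝ] A) (P Q : ℤ → Submodule ℝ A) (n : ℤ) : Submodule ℝ A :=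
  Gsub d e P Q n ⊓ LinearMap.ker d

/-- Coboundaries of `G`. -/
def BG (d e : A →ₗ[ℝ] A) (P Q : ℤ → Submodule ℝ A) (n : ℤ) : Submodule ℝ A :=
  (Gsub d e P Q (n - 1)).map d

/-- `H^n(G)`. -/
abbrev HG (d e : A →ₗ[ℝ] A) (P Q : ℤ → Submodule ℝ A) (n : ℤ) :=
  Hq (ZG d e P Q n) (BG d e P Q n)

/-- The co-Gysin space `𝒦^n = Ω^n / G^n` (cochain level). -/
abbrev Kq (d e : A →ₗ[ℝ] A) (P Q : ℤ → Submodule ℝ A) (n : ℤ) :=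
  (Om d P n) ⧸ ((Gsub d e P Q n).comap (Om d P n).subtype)

/-- Cocycles of the co-Gysin complex `𝒦 = Ω/G`, presented by representatives:
`α ∈ Ω^n` with `dα ∈ G^(n+1)`. -/
def ZKo (d e : A →ₗ[ℝ] A) (P Q : ℤ → Submodule ℝ A) (n : ℤ) : Submodule ℝ A :=
  Om d P n ⊓ (Gsub d e P Q (n + 1)).comap d

/-- Representatives of coboundaries of `𝒦 = Ω/G`. -/
def BKo (d e : A →ₗ[ℝ] A) (P Q : ℤ → Submodule ℝ A) (n : ℤ) : Submodule ℝ A :=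
  Gsub d e P Q n ⊔ (Om d P (n - 1)).map d

/-- `H^n(𝒦)`. -/
abbrev HKo (d e : A →ₗ[ℝ] A) (P Q : ℤ → Submodule ℝ A) (n : ℤ) :=
  Hq (ZKo d e P Q n) (BKo d e P Q n)

/-- Cocycles of `(C, ∇)`. -/
def ZC (d e : A →ₗ[ℝ] A) (P Q : ℤ → Submodule ℝ A) (m : ℤ) : Submodule ℝ (ℕ → A × A) :=
  Csub d e P Q m ⊓ LinearMap.ker (nabla d e m)

/-- Coboundaries of `(C, ∇)`. -/
def BC (d e : A →ₗ[ℝ] A) (P Q : ℤ → Submodule ℝ A) (m : ℤ) : Submodule ℝ (ℕ → A × A) :=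
  (Csub d e P Q (m - 1)).map (nabla d e (m - 1))

/-- `H^m(C)`, the equivariant intersection cohomology. -/
abbrev HC (d e : A →ₗ[ℝ] A) (P Q : ℤ → Submodule ℝ A) (m : ℤ) :=
  Hq (ZC d e P Q m) (BC d e P Q m)

/-- Cocycles of `(Ω ⊗ ℝ[u], d ⊗ 1)`. -/
def ZOmC (d : A →ₗ[ℝ] A) (P : ℤ → Submodule ℝ A) (m : ℤ) : Submodule ℝ (ℕ → A) :=
  OmC d P m ⊓ LinearMap.ker (dpi d)

/-- Coboundaries of `(Ω ⊗ ℝ[u], d ⊗ 1)`. -/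
def BOmC (d : A →ₗ[ℝ] A) (P : ℤ → Submodule ℝ A) (m : ℤ) : Submodule ℝ (ℕ → A) :=
  (OmC d P (m - 1)).map (dpi d)

/-- `[H(Ω) ⊗ ℝ[u]]^m`, as the cohomology of the complex `(Ω ⊗ ℝ[u], d ⊗ 1)`. -/
abbrev HOmCq (d : A →ₗ[ℝ] A) (P : ℤ → Submodule ℝ A) (m : ℤ) :=
  Hq (ZOmC d P m) (BOmC d P m)

/-- Cocycles of `(G[-1] ⊗ ℝ[u], d ⊗ 1)`. -/
def ZGC (d e : A →ₗ[ℝ] A) (P Q : ℤ → Submodule ℝ A) (m : ℤ) : Submodule ℝ (ℕ → A) :=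
  GCs d e P Q m ⊓ LinearMap.ker (dpi d)

/-- Coboundaries of `(G[-1] ⊗ ℝ[u], d ⊗ 1)`. -/
def BGC (d e : A →ₗ[ℝ] A) (P Q : ℤ → Submodule ℝ A) (m : ℤ) : Submodule ℝ (ℕ → A) :=
  (GCs d e P Q (m - 1)).map (dpi d)

/-- `[H(G) ⊗ ℝ[u]]^(m-1)`, as the cohomology of `(G[-1] ⊗ ℝ[u], d ⊗ 1)` in degree `m`. -/
abbrev HGCq (d e : A →ₗ[ℝ] A) (P Q : ℤ → Submodule ℝ A) (m : ℤ) :=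
  Hq (ZGC d e P Q m) (BGC d e P Q m)

/-- The subspace of `ω : ℕ → A × A` supported in (filtration) degrees `≥ i`
(for total degree `m`): `ω j = 0` whenever `m - 2j < i`. -/
def Supp (i m : ℤ) : Submodule ℝ (ℕ → A × A) :=
  ⨅ (j : ℕ) (_ : m - 2 * (j : ℤ) < i),
    LinearMap.ker (LinearMap.proj (R := ℝ) (φ := fun _ : ℕ => A × A) j)

/-- The filtration `F^i C^m = {ω ∈ ⊕_{i'≥i} K^{i'} ⊗ ℝ[u] of total degree m :
∇ω ∈ ⊕_{i'≥i} K^{i'} ⊗ ℝ[u]}`. -/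
def FC (d e : A →ₗ[ℝ] A) (P Q : ℤ → Submodule ℝ A) (i m : ℤ) : Submodule ℝ (ℕ → A × A) :=
  Csub d e P Q m ⊓ Supp i m ⊓ (Supp i (m + 1)).comap (nabla d e m)

/-- `Z_r^{i,j} = F^i C^(i+j) ∩ ∇⁻¹(F^(i+r) C^(i+j+1))`. -/
def Zsp (d e : A →ₗ[ℝ] A) (P Q : ℤ → Submodule ℝ A) (r i j : ℤ) : Submodule ℝ (ℕ → A × A) :=
  FC d e P Q i (i + j) ⊓ (FC d e P Q (i + r) (i + j + 1)).comap (nabla d e (i + j))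

/-- `B_r^{i,j} = F^i C^(i+j) ∩ ∇(F^(i-r) C^(i+j-1))`. -/
def Bsp (d e : A →ₗ[ℝ] A) (P Q : ℤ → Submodule ℝ A) (r i j : ℤ) : Submodule ℝ (ℕ → A × A) :=
  FC d e P Q i (i + j) ⊓ (FC d e P Q (i - r) (i + j - 1)).map (nabla d e (i + j - 1))

/-- `E_r^{i,j} = Z_r^{i,j} / (Z_(r-1)^{i+1,j-1} + B_(r-1)^{i,j})`. -/
abbrev Esp (d e : A →ₗ[ℝ] A) (P Q : ℤ → Submodule ℝ A) (r i j : ℤ) :=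
  Zsp d e P Q r i j ⧸
    ((Zsp d e P Q (r - 1) (i + 1) (j - 1) ⊔ Bsp d e P Q (r - 1) i j).comap
      (Zsp d e P Q r i j).subtype)

/-- The differential `d_r : E_r^{i,j} → E_r^{i+r,j-r+1}` is the map induced by `∇`
(the target indices `(i', j')` are given freely, to be instantiated by
expressions equal to `(i + r, j - r + 1)`). -/
def DrChar (d e : A →ₗ[ℝ] A) (P Q : ℤ → Submodule ℝ A) (r i j i' j' : ℤ)
    (dr : Esp d e P Q r i j →ₗ[ℝ] Esp d e P Q r i' j') : Prop :=
  ∀ (ω : ℕ → A × A) (hω : ω ∈ Zsp d e P Q r i j)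
    (hω' : nabla d e (i + j) ω ∈ Zsp d e P Q r i' j'),
    dr (Submodule.Quotient.mk ⟨ω, hω⟩) = Submodule.Quotient.mk ⟨nabla d e (i + j) ω, hω'⟩

/-- `α ↦ (α, 0) ⊗ u^0 = (α,0) ⊗ 1`. -/
def embL : A →ₗ[ℝ] ℕ → A × A :=
  LinearMap.single ℝ (fun _ : ℕ => A × A) 0 ∘ₗ LinearMap.inl ℝ A A

/-- `ι̃ : H^n(G) → H^{n'}(Ω)` induced by the inclusion `G ⊆ Ω` (`n' = n`). -/
def iotaChar (d e : A →ₗ[ℝ] A) (P Q : ℤ → Submodule ℝ A) (n n' : ℤ)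
    (ι : HG d e P Q n →ₗ[ℝ] HOm d P n') : Prop :=
  ∀ (β : A) (hβ : β ∈ ZG d e P Q n) (hβ' : β ∈ ZOm d P n'),
    ι (Submodule.Quotient.mk ⟨β, hβ⟩) = Submodule.Quotient.mk ⟨β, hβ'⟩

/-- `𝕖 : H^n(G) → H^{n'}(Ω)`, `𝕖[β] = [dα + (-1)^n β∧ε]` for any witness `α`
(`n' = n + 2`). -/
def eulerChar (d e : A →ₗ[ℝ] A) (P Q : ℤ → Submodule ℝ A) (n n' : ℤ)
    (E : HG d e P Q n →ₗ[ℝ] HOm d P n') : Prop :=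
  ∀ (β : A) (hβ : β ∈ ZG d e P Q n) (α : A) (_ : α ∈ P (n + 1))
    (hz : d α + ((-1 : ℝ) ^ n) • e β ∈ ZOm d P n'),
    E (Submodule.Quotient.mk ⟨β, hβ⟩) =
      Submodule.Quotient.mk ⟨d α + ((-1 : ℝ) ^ n) • e β, hz⟩

/-- `∂ : H^n(𝒦) → H^{n'}(G)`, `∂[ᾱ] = [dα]` (`n' = n + 1`). -/
def partialChar (d e : A →ₗ[ℝ] A) (P Q : ℤ → Submodule ℝ A) (n n' : ℤ)
    (pd : HKo d e P Q n →ₗ[ℝ] HG d e P Q n') : Prop :=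
  ∀ (α : A) (hα : α ∈ ZKo d e P Q n) (hd : d α ∈ ZG d e P Q n'),
    pd (Submodule.Quotient.mk ⟨α, hα⟩) = Submodule.Quotient.mk ⟨d α, hd⟩

/-- `Pr : H^n(Ω) → H^{n'}(𝒦)` induced by the projection `Ω → 𝒦 = Ω/G` (`n' = n`). -/
def prChar (d e : A →ₗ[ℝ] A) (P Q : ℤ → Submodule ℝ A) (n n' : ℤ)
    (pr : HOm d P n →ₗ[ℝ] HKo d e P Q n') : Prop :=
  ∀ (α : A) (hα : α ∈ ZOm d P n) (hα' : α ∈ ZKo d e P Q n'),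
    pr (Submodule.Quotient.mk ⟨α, hα⟩) = Submodule.Quotient.mk ⟨α, hα'⟩

lemma mem_Ksub {d e : A →ₗ[ℝ] A} {P Q : ℤ → Submodule ℝ A} {n : ℤ} {x : A × A} :
    x ∈ Ksub d e P Q n ↔ x.1 ∈ P n ∧ x.2 ∈ Q (n - 1) ∧ d x.2 ∈ Q n ∧
      d x.1 + (-1 : ℝ) ^ (n - 1) • e x.2 ∈ P (n + 1) := by
  simp [Ksub, D1, and_assoc]

lemma mem_Csub {d e : A →ₗ[ℝ] A} {P Q : ℤ → Submodule ℝ A} {m : ℤ} {ω : ℕ → A × A} :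
    ω ∈ Csub d e P Q m ↔ ∀ j : ℕ, ω j ∈ Ksub d e P Q (m - 2 * (j : ℤ)) := by
  simp [Csub]

lemma mem_Supp {i m : ℤ} {ω : ℕ → A × A} :
    ω ∈ Supp i m ↔ ∀ j : ℕ, m - 2 * (j : ℤ) < i → ω j = 0 := by
  simp [Supp]

lemma mem_FC {d e : A →ₗ[ℝ] A} {P Q : ℤ → Submodule ℝ A} {i m : ℤ} {ω : ℕ → A × A} :
    ω ∈ FC d e P Q i m ↔
      ω ∈ Csub d e P Q m ∧ ω ∈ Supp i m ∧ nabla d e m ω ∈ Supp i (m + 1) := by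
  simp [FC, and_assoc]

lemma neg_one_zpow_sub_two_mul (m k : ℤ) : (-1 : ℝ) ^ (m - 2 * k) = (-1) ^ m := by
  rw [zpow_sub₀ (by norm_num), zpow_mul]
  norm_num

lemma nabla_zero (d e : A →ₗ[ℝ] A) (m : ℤ) (ω : ℕ → A × A) :
    nabla d e m ω 0 = (d (ω 0).1 + (-1 : ℝ) ^ (m - 1) • e (ω 0).2, d (ω 0).2) := by
  simp [nabla, Dmap, D1]

lemma nabla_succ (d e : A →ₗ[ℝ] A) (m : ℤ) (ω : ℕ → A × A) (j : ℕ) :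
    nabla d e m ω (j + 1) =
      (d (ω (j + 1)).1 + (-1 : ℝ) ^ (m - 1) • e (ω (j + 1)).2 + (-1 : ℝ) ^ (m - 1) • (ω j).2,
        d (ω (j + 1)).2) := by
  have h₁ : (-1 : ℝ) ^ (m - 2 * ((j : ℤ) + 1) - 1) = (-1) ^ (m - 1) := by
    rw [sub_right_comm, neg_one_zpow_sub_two_mul]
  have h₂ : (-1 : ℝ) ^ (m - 2 * (j : ℤ) - 1) = (-1) ^ (m - 1) := by
    rw [sub_right_comm, neg_one_zpow_sub_two_mul]
  simp [nabla, Dmap, D1, h₁, h₂]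

lemma neg_one_zpow_eq_neg (m : ℤ) : (-1 : ℝ) ^ m = -(-1) ^ (m - 1) := by
  rw [zpow_sub_one₀ (by norm_num)]
  norm_num

/-- `∇² = 0`. -/
lemma nabla_nabla {d e : A →ₗ[ℝ] A} (hd : d ∘ₗ d = 0) (hde : d ∘ₗ e = e ∘ₗ d) (m : ℤ)
    (ω : ℕ → A × A) : nabla d e (m + 1) (nabla d e m ω) = 0 := by
  have hd' (x : A) : d (d x) = 0 := LinearMap.congr_fun hd x
  have hde' (x : A) : d (e x) = e (d x) := LinearMap.congr_fun hde x
  funext j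
  rcases j with _ | _ | j <;>
    simp [nabla_zero, nabla_succ, hd', hde', neg_one_zpow_eq_neg m]

lemma nabla_mem_Csub {d e : A →ₗ[ℝ] A} (hd : d ∘ₗ d = 0) (hde : d ∘ₗ e = e ∘ₗ d)
    {P Q : ℤ → Submodule ℝ A} (hQP : ∀ n, Q n ≤ P n) {m : ℤ} {ω : ℕ → A × A}
    (hω : ω ∈ Csub d e P Q m) : nabla d e m ω ∈ Csub d e P Q (m + 1) := by
  have hd' (x : A) : d (d x) = 0 := LinearMap.congr_fun hd x
  have hde' (x : A) : d (e x) = e (d x) := LinearMap.congr_fun hde x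
  rw [mem_Csub] at hω ⊢
  have hsgn (j : ℕ) : (-1 : ℝ) ^ (m - 2 * (j : ℤ) - 1) = (-1) ^ (m - 1) := by
    rw [sub_right_comm, neg_one_zpow_sub_two_mul]
  have hsgn' (j : ℕ) : (-1 : ℝ) ^ (m + 1 - 2 * (j : ℤ) - 1) = -(-1) ^ (m - 1) := by
    rw [sub_right_comm, neg_one_zpow_sub_two_mul, add_sub_cancel_right, neg_one_zpow_eq_neg]
  intro j
  obtain ⟨-, -, hb, hD⟩ := mem_Ksub.1 (hω j)
  rw [hsgn, show m - 2 * (j : ℤ) + 1 = m + 1 - 2 * j by ring] at hD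
  rw [show m - 2 * (j : ℤ) = m + 1 - 2 * j - 1 by ring] at hb
  rw [mem_Ksub, hsgn']
  rcases j with _ | j
  · rw [nabla_zero]
    refine ⟨hD, hb, ?_, ?_⟩ <;> simp [hd', hde']
  · obtain ⟨-, hb', hdb', -⟩ := mem_Ksub.1 (hω j)
    rw [show m - 2 * (j : ℤ) - 1 = m + 1 - 2 * ((j + 1 : ℕ) : ℤ) by push_cast; ring] at hb'
    rw [show m - 2 * (j : ℤ) = m + 1 - 2 * ((j + 1 : ℕ) : ℤ) + 1 by push_cast; ring] at hdb'
    rw [nabla_succ]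
    refine ⟨add_mem hD (Submodule.smul_mem _ _ (hQP _ hb')), hb, ?_, ?_⟩
    · simp [hd']
    · simpa [hd', hde'] using Submodule.smul_mem _ _ (hQP _ hdb')

lemma Csub_le_Supp_zero {d e : A →ₗ[ℝ] A} {P Q : ℤ → Submodule ℝ A}
    (hP : ∀ n : ℤ, n < 0 → P n = ⊥) (hQ : ∀ n : ℤ, n < 0 → Q n = ⊥) (m : ℤ) :
    Csub d e P Q m ≤ Supp 0 m := by
  intro ω hω
  rw [mem_Supp]
  intro j hj
  obtain ⟨ha, hb, -, -⟩ := mem_Ksub.1 (mem_Csub.1 hω j)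
  rw [hP _ hj, Submodule.mem_bot] at ha
  rw [hQ _ (by lia), Submodule.mem_bot] at hb
  exact Prod.ext ha hb

lemma mem_FC_even {d e : A →ₗ[ℝ] A} {P Q : ℤ → Submodule ℝ A} {i : ℤ} {j : ℕ}
    {ω : ℕ → A × A} : ω ∈ FC d e P Q i (i + 2 * (j : ℤ)) ↔
      ω ∈ Csub d e P Q (i + 2 * (j : ℤ)) ∧ ((ω j).1 ∈ Om d P i ∧ (ω j).2 = 0) ∧
        ∀ p : ℕ, j < p → ω p = 0 := by
  rw [mem_FC, mem_Supp, mem_Supp]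
  constructor
  · rintro ⟨hC, hs, hn⟩
    have hz (p : ℕ) (hp : j < p) : ω p = 0 := hs p (by lia)
    have hb : (ω j).2 = 0 := by
      have h := hn (j + 1) (by push_cast; lia)
      rw [nabla_succ, hz _ j.lt_succ_self] at h
      simpa [zpow_ne_zero] using congrArg Prod.fst h
    obtain ⟨ha, -, -, hD⟩ := mem_Ksub.1 (mem_Csub.1 hC j)
    simp only [add_sub_cancel_right, hb, map_zero, smul_zero, add_zero] at ha hD
    exact ⟨hC, ⟨⟨ha, hD⟩, hb⟩, hz⟩
  · rintro ⟨hC, ⟨-, hb⟩, hz⟩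
    refine ⟨hC, fun p hp => hz p (by lia), fun p hp => ?_⟩
    obtain ⟨p, rfl⟩ : ∃ q, p = q + 1 := ⟨p - 1, by lia⟩
    have hb' : (ω p).2 = 0 := by
      rcases (show j ≤ p by lia).eq_or_lt with rfl | h
      · exact hb
      · rw [hz p h, Prod.snd_zero]
    simp [nabla_succ, hz (p + 1) (by lia), hb']

lemma mem_FC_odd {d e : A →ₗ[ℝ] A} {P Q : ℤ → Submodule ℝ A} {i : ℤ} {j : ℕ}
    {ω : ℕ → A × A} : ω ∈ FC d e P Q i (i + 2 * (j : ℤ) + 1) ↔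
      ω ∈ Csub d e P Q (i + 2 * (j : ℤ) + 1) ∧ ∀ p : ℕ, j < p → ω p = 0 := by
  rw [mem_FC, mem_Supp, mem_Supp]
  refine ⟨fun ⟨hC, hs, _⟩ => ⟨hC, fun p hp => hs p (by lia)⟩, fun ⟨hC, hz⟩ =>
    ⟨hC, fun p hp => hz p (by lia), fun p hp => ?_⟩⟩
  obtain ⟨p, rfl⟩ : ∃ q, p = q + 1 := ⟨p - 1, by lia⟩
  simp [nabla_succ, hz (p + 1) (by lia), hz p (by lia)]

/-- description of the filtration `F^i C^m`.
(i) `F^i C^(i+2j) = (Ω^i × {0}) ⊗ ℝ·u^j ⊕ ⊕_{k=1}^{j} K^(i+2k) ⊗ ℝ·u^(j-k)` and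
`F^i C^(i+2j+1) = K^(i+1) ⊗ ℝ·u^j ⊕ ⊕_{k=1}^{j} K^(i+1+2k) ⊗ ℝ·u^(j-k)`
(in our function model: the coefficient of `u^j` lies in `Ω^i × {0}` (even case),
the coefficients of `u^p` with `p > j` vanish, and the coefficients of `u^p`, `p < j`,
lie in the appropriate `K`, which is the defining condition of `C^m`);
(ii) `∇(F^i C^m) ⊆ F^i C^(m+1)`;
(iii) `F^0 C^m = C^m` and `F^(m+1) C^m = 0`. -/
theorem statement_5 {A : Type*} [AddCommGroup A] [Module ℝ A]
    (d e : A →ₗ[ℝ] A) (hd : d ∘ₗ d = 0) (hde : d ∘ₗ e = e ∘ₗ d)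
    (P Q : ℤ → Submodule ℝ A) (hQP : ∀ n, Q n ≤ P n)
    (hPneg : ∀ n : ℤ, n < 0 → P n = ⊥) (hQneg : ∀ n : ℤ, n < 0 → Q n = ⊥) :
    -- (i), even total degree
    (∀ i : ℤ, 0 ≤ i → ∀ j : ℕ,
      FC d e P Q i (i + 2 * (j : ℤ)) =
        Csub d e P Q (i + 2 * (j : ℤ)) ⊓
          ((Om d P i).prod (⊥ : Submodule ℝ A)).comap (LinearMap.proj (R := ℝ) j) ⊓
          ⨅ (p : ℕ) (_ : j < p),
            LinearMap.ker (LinearMap.proj (R := ℝ) (φ := fun _ : ℕ => A × A) p)) ∧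
    -- (i), odd total degree
    (∀ i : ℤ, 0 ≤ i → ∀ j : ℕ,
      FC d e P Q i (i + 2 * (j : ℤ) + 1) =
        Csub d e P Q (i + 2 * (j : ℤ) + 1) ⊓
          ⨅ (p : ℕ) (_ : j < p),
            LinearMap.ker (LinearMap.proj (R := ℝ) (φ := fun _ : ℕ => A × A) p)) ∧
    -- (ii)
    (∀ i m : ℤ, (FC d e P Q i m).map (nabla d e m) ≤ FC d e P Q i (m + 1)) ∧
    -- (iii)
    (∀ m : ℤ, FC d e P Q 0 m = Csub d e P Q m) ∧
    (∀ m : ℤ, FC d e P Q (m + 1) m = ⊥) := by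
  refine ⟨fun i _ j => ?_, fun i _ j => ?_, fun i m => ?_, fun m => ?_, fun m => ?_⟩
  · ext ω
    rw [mem_FC_even]
    simp [Submodule.mem_prod, and_assoc]
  · ext ω
    rw [mem_FC_odd]
    simp
  · rw [Submodule.map_le_iff_le_comap]
    intro ω hω
    obtain ⟨hC, -, hn⟩ := mem_FC.1 hω
    rw [Submodule.mem_comap, mem_FC, nabla_nabla hd hde]
    exact ⟨nabla_mem_Csub hd hde hQP hC, hn, zero_mem _⟩
  · ext ω
    rw [mem_FC]
    exact ⟨And.left, fun h => ⟨h, Csub_le_Supp_zero hPneg hQneg _ h,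
      Csub_le_Supp_zero hPneg hQneg _ (nabla_mem_Csub hd hde hQP h)⟩⟩
  · refine (Submodule.eq_bot_iff _).2 fun ω hω => funext fun j => ?_
    exact mem_Supp.1 (mem_FC.1 hω).2.1 j (by lia)

end IG

end
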